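/- arXiv:0812.4696 — 3 statements merged into one kernel-verified Lean document; each statement's English description precedes it below -/
import Mathlib

section
/- Let G = ⟨x⟩ be an infinite cyclic group written multiplicatively and let T₁(G) be the single-label order-1 intersection-tree group, with (g,h) denoting the class of Y(∗,∗,∗;1,g,h). Then T₁(G) is the internal direct sum of a free abelian subgroup with basis { (x^m, x^n) : m,n ∈ ℤ, 1 ≤ m < n } and an elementary abelian 2-group with basis { (x^r, x^r) : r ∈ ℤ, 0 ≤ r }; in particular T₁(G) ≅ (⨁_{n∈ℕ} ℤ) × (⨁_{n∈ℕ} ℤ/2ℤ). -/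
namespace Paper

variable (G : Type) [Group G] (ι : Type)

/-- Relator set for the order-1 intersection-tree group `T₁(G;ι)`:
(CYC) `Y(i,j,k;a,b,c) = Y(j,k,i;b,c,a)`;
(AS) `Y(i,j,k;a,b,c) = −Y(i,k,j;a,c,b)`;
(HOL) `Y(i,j,k;a,b,c) = Y(i,j,k;ag,bg,cg)`;
(FR) `Y(i,j,i;a,b,a) = Y(i,j,j;a,b,b)`. -/
def T1Rels : Set (FreeAbelianGroup (ι × ι × ι × G × G × G)) :=
  { x | (∃ i j k a b c, x = FreeAbelianGroup.of (i,j,k,a,b,c) - FreeAbelianGroup.of (j,k,i,b,c,a))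
      ∨ (∃ i j k a b c, x = FreeAbelianGroup.of (i,j,k,a,b,c) + FreeAbelianGroup.of (i,k,j,a,c,b))
      ∨ (∃ i j k a b c g, x = FreeAbelianGroup.of (i,j,k,a,b,c)
            - FreeAbelianGroup.of (i,j,k,a*g,b*g,c*g))
      ∨ (∃ i j a b, x = FreeAbelianGroup.of (i,j,i,a,b,a) - FreeAbelianGroup.of (i,j,j,a,b,b)) }

/-- The order-1 intersection-tree group `T₁(G;ι)`. -/
abbrev T1 := FreeAbelianGroup (ι × ι × ι × G × G × G) ⧸ AddSubgroup.closure (T1Rels G ι)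

/-- Class of the generator `Y(i,j,k;a,b,c)` in `T₁(G;ι)`. -/
def Y (i j k : ι) (a b c : G) : T1 G ι :=
  QuotientAddGroup.mk (FreeAbelianGroup.of (i,j,k,a,b,c))

/-- The pair notation `(g,h) := Y(∗,∗,∗;1,g,h)` in the single-label group `T₁(G)`. -/
def pairY (g h : G) : T1 G Unit := Y G Unit () () () 1 g h

/-- The candidate normal form `(⨁ ℤ) × (⨁ ZMod 2)` of `T₁(ℤ)`. -/
abbrev NormalForm : Type :=
  DirectSum {p : ℤ × ℤ // 1 ≤ p.1 ∧ p.1 < p.2} (fun _ => ℤ) ×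
    DirectSum {r : ℤ // 0 ≤ r} (fun _ => ZMod 2)

namespace NormalForm

/-- The free generator at `(m - l, n - l)` if `l < m < n`, and `0` otherwise. -/
noncomputable def free (l m n : ℤ) : NormalForm :=
  if h : 1 ≤ m - l ∧ m - l < n - l then
    (DirectSum.of (fun _ : {p : ℤ × ℤ // 1 ≤ p.1 ∧ p.1 < p.2} => ℤ) ⟨(m - l, n - l), h⟩ 1, 0)
  else 0

/-- The 2-torsion generator at `|r|`. -/
noncomputable def tor (r : ℤ) : NormalForm :=
  (0, DirectSum.of (fun _ : {r : ℤ // 0 ≤ r} => ZMod 2) ⟨|r|, abs_nonneg r⟩ 1)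

/-- The free part of the normal form of `Y(x^l, x^m, x^n)`: antisymmetrization of `free`. -/
noncomputable def alt (l m n : ℤ) : NormalForm :=
  free l m n + free m n l + free n l m - free l n m - free n m l - free m l n

/-- The torsion part of the normal form of `Y(x^l, x^m, x^n)`. -/
noncomputable def deg (l m n : ℤ) : NormalForm :=
  if l = m then tor (n - l) else if m = n then tor (m - l) else if n = l then tor (m - l) else 0

/-- The normal form of `Y(x^l, x^m, x^n)`. -/
noncomputable def ofTriple (l m n : ℤ) : NormalForm := alt l m n + deg l m n

theorem tor_add_self (r : ℤ) : tor r + tor r = 0 := by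
  have h : (1 + 1 : ZMod 2) = 0 := by decide
  simp only [tor, Prod.mk_add_mk, ← map_add, h, map_zero, add_zero, Prod.mk_zero_zero]

theorem tor_neg (r : ℤ) : tor (-r) = tor r := by
  simp only [tor, abs_neg]

theorem tor_sub_comm (r s : ℤ) : tor (r - s) = tor (s - r) := by
  rw [← tor_neg, neg_sub]

theorem deg_cyc (l m n : ℤ) : deg l m n = deg m n l := by
  unfold deg
  split_ifs <;> subst_vars <;> first | rfl | exact tor_sub_comm _ _

theorem deg_swap (l m n : ℤ) : deg l m n = deg l n m := by
  unfold deg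
  split_ifs <;> subst_vars <;> first | rfl | exact tor_sub_comm _ _ | omega

theorem deg_add_self (l m n : ℤ) : deg l m n + deg l m n = 0 := by
  unfold deg
  split_ifs <;> simp only [tor_add_self, add_zero]

theorem ofTriple_cyc (l m n : ℤ) : ofTriple l m n = ofTriple m n l := by
  unfold ofTriple alt
  rw [deg_cyc]
  abel

theorem ofTriple_add_swap (l m n : ℤ) : ofTriple l m n + ofTriple l n m = 0 := by
  have h := deg_add_self l m n
  unfold ofTriple
  rw [← deg_swap l m n, add_add_add_comm, h]
  unfold alt
  abel

theorem ofTriple_add_right (l m n g : ℤ) :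
    ofTriple (l + g) (m + g) (n + g) = ofTriple l m n := by
  simp only [ofTriple, alt, deg, free, add_sub_add_right_eq_sub, add_left_inj]

theorem ofTriple_framing (l m : ℤ) : ofTriple l m l = ofTriple l m m := by
  have h₁ : alt l m l = 0 := by unfold alt; abel
  have h₂ : alt l m m = 0 := by unfold alt; abel
  have h₃ : deg l m l = deg l m m := by
    unfold deg
    split_ifs <;> subst_vars <;> first | rfl | omega
  rw [ofTriple, ofTriple, h₁, h₂, h₃]

theorem ofTriple_zero_of_lt {m n : ℤ} (h : 1 ≤ m ∧ m < n) :
    ofTriple 0 m n =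
      (DirectSum.of (fun _ : {p : ℤ × ℤ // 1 ≤ p.1 ∧ p.1 < p.2} => ℤ) ⟨(m, n), h⟩ 1, 0) := by
  obtain ⟨h₁, h₂⟩ := h
  have hd : deg 0 m n = 0 := by
    rw [deg, if_neg (by omega), if_neg (by omega), if_neg (by omega)]
  rw [ofTriple, hd, alt]
  unfold free
  rw [dif_pos (by omega), dif_neg (by omega), dif_neg (by omega), dif_neg (by omega),
    dif_neg (by omega), dif_neg (by omega)]
  simp only [sub_zero, add_zero]

theorem ofTriple_zero_self {r : ℤ} (h : 0 ≤ r) :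
    ofTriple 0 r r = (0, DirectSum.of (fun _ : {r : ℤ // 0 ≤ r} => ZMod 2) ⟨r, h⟩ 1) := by
  have ha : alt 0 r r = 0 := by unfold alt; abel
  have hd : deg 0 r r = tor r := by
    unfold deg
    rw [if_pos rfl, sub_zero, ite_self]
  rw [ofTriple, ha, hd, zero_add, tor]
  simp only [abs_of_nonneg h]

/-- Additive maps out of the normal form agree if they agree on the standard generators. -/
theorem hom_ext {A : Type*} [AddCommGroup A] {f g : NormalForm →+ A}
    (hfree : ∀ m n : ℤ, 1 ≤ m ∧ m < n → f (ofTriple 0 m n) = g (ofTriple 0 m n))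
    (htor : ∀ r : ℤ, 0 ≤ r → f (ofTriple 0 r r) = g (ofTriple 0 r r)) : f = g := by
  rw [← AddMonoidHom.coprod_unique f, ← AddMonoidHom.coprod_unique g]
  congr 1
  · refine DirectSum.addHom_ext' fun ⟨⟨m, n⟩, h⟩ => AddMonoidHom.ext_int ?_
    simpa [ofTriple_zero_of_lt h] using hfree m n h
  · refine DirectSum.addHom_ext' fun ⟨r, h⟩ =>
      (AddMonoidHom.cancel_right (ZMod.ringHom_surjective (Int.castRingHom (ZMod 2)))).mp
        (AddMonoidHom.ext_int (f := AddMonoidHom.comp _ (Int.castRingHom (ZMod 2)).toAddMonoidHom)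
          (g := AddMonoidHom.comp _ (Int.castRingHom (ZMod 2)).toAddMonoidHom) ?_)
    simpa [ofTriple_zero_self h] using htor r h

/-- An antisymmetric, translation-invariant function of triples satisfying the framing relation
is determined by its values on `(0, m, n)` with `1 ≤ m < n` and on `(0, r, r)` with `0 ≤ r`. -/
theorem map_ofTriple {A : Type*} [AddCommGroup A] (f : NormalForm →+ A) (y : ℤ → ℤ → ℤ → A)
    (cyc : ∀ l m n, y l m n = y m n l)
    (swap : ∀ l m n, y l m n = -y l n m)
    (hol : ∀ l m n g, y (l + g) (m + g) (n + g) = y l m n)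
    (fr : ∀ l m, y l m l = y l m m)
    (hfree : ∀ m n, 1 ≤ m ∧ m < n → f (ofTriple 0 m n) = y 0 m n)
    (htor : ∀ r, 0 ≤ r → f (ofTriple 0 r r) = y 0 r r) (l m n : ℤ) :
    f (ofTriple l m n) = y l m n := by
  have hcyc : ∀ l m n, f (ofTriple l m n) = y l m n → f (ofTriple m n l) = y m n l := by
    intro l m n h
    rw [← ofTriple_cyc, ← cyc, h]
  have hswap : ∀ l m n, f (ofTriple l m n) = y l m n → f (ofTriple l n m) = y l n m := by
    intro l m n h
    rw [eq_neg_of_add_eq_zero_left (ofTriple_add_swap l n m), map_neg, h, swap l n m]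
  have hsorted : ∀ l m n, l ≤ m → m ≤ n → f (ofTriple l m n) = y l m n := by
    intro l m n hlm hmn
    have key : f (ofTriple 0 (m - l) (n - l)) = y 0 (m - l) (n - l) := by
      rcases hmn.eq_or_lt with rfl | hmn
      · exact htor _ (by omega)
      · rcases hlm.eq_or_lt with rfl | hlm
        · have h₁ := htor (n - l) (by omega)
          rw [sub_self]
          exact hcyc _ _ _ (hcyc _ _ _ (by rw [ofTriple_framing, fr, h₁]))
        · exact hfree _ _ (by omega)
    rw [← ofTriple_add_right _ _ _ l, ← hol _ _ _ l] at key
    simpa only [zero_add, sub_add_cancel] using key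
  rcases le_total l m with h₁ | h₁ <;> rcases le_total m n with h₂ | h₂ <;>
    rcases le_total l n with h₃ | h₃
  · exact hsorted _ _ _ h₁ h₂
  · exact hsorted _ _ _ h₁ h₂
  · exact hswap _ _ _ (hsorted _ _ _ h₃ h₂)
  · exact hcyc _ _ _ (hsorted _ _ _ h₃ h₁)
  · exact hswap _ _ _ (hcyc _ _ _ (hsorted _ _ _ h₁ h₃))
  · exact hcyc _ _ _ (hcyc _ _ _ (hsorted _ _ _ h₂ h₃))
  · exact hswap _ _ _ (hcyc _ _ _ (hcyc _ _ _ (hsorted _ _ _ h₂ h₁)))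
  · exact hswap _ _ _ (hcyc _ _ _ (hcyc _ _ _ (hsorted _ _ _ h₂ h₁)))

end NormalForm

section

variable {G ι}

theorem Y_cyc (i j k : ι) (a b c : G) : Y G ι i j k a b c = Y G ι j k i b c a :=
  sub_eq_zero.mp ((QuotientAddGroup.eq_zero_iff _).mpr
    (AddSubgroup.subset_closure (Or.inl ⟨i, j, k, a, b, c, rfl⟩)))

theorem Y_swap (i j k : ι) (a b c : G) : Y G ι i j k a b c = -Y G ι i k j a c b :=
  eq_neg_of_add_eq_zero_left ((QuotientAddGroup.eq_zero_iff _).mpr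
    (AddSubgroup.subset_closure (Or.inr (Or.inl ⟨i, j, k, a, b, c, rfl⟩))))

theorem Y_mul_right (i j k : ι) (a b c g : G) :
    Y G ι i j k a b c = Y G ι i j k (a * g) (b * g) (c * g) :=
  sub_eq_zero.mp ((QuotientAddGroup.eq_zero_iff _).mpr
    (AddSubgroup.subset_closure (Or.inr (Or.inr (Or.inl ⟨i, j, k, a, b, c, g, rfl⟩)))))

theorem Y_framing (i j : ι) (a b : G) : Y G ι i j i a b a = Y G ι i j j a b b :=
  sub_eq_zero.mp ((QuotientAddGroup.eq_zero_iff _).mpr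
    (AddSubgroup.subset_closure (Or.inr (Or.inr (Or.inr ⟨i, j, a, b, rfl⟩)))))

theorem pairY_self_add_self (g : G) : pairY G g g + pairY G g g = 0 := by
  nth_rewrite 1 [pairY, Y_swap]
  exact neg_add_cancel _

/-- The homomorphism to `NormalForm` induced by an exponent function `log : G → ℤ`. -/
noncomputable def toNormalForm (log : G → ℤ) (hlog : ∀ a b, log (a * b) = log a + log b) :
    T1 G Unit →+ NormalForm :=
  QuotientAddGroup.lift _
    (FreeAbelianGroup.lift fun t : Unit × Unit × Unit × G × G × G =>
      NormalForm.ofTriple (log t.2.2.2.1) (log t.2.2.2.2.1) (log t.2.2.2.2.2)) (by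
    rw [AddSubgroup.closure_le]
    rintro _ (⟨i, j, k, a, b, c, rfl⟩ | ⟨i, j, k, a, b, c, rfl⟩ | ⟨i, j, k, a, b, c, g, rfl⟩ |
      ⟨i, j, a, b, rfl⟩)
    all_goals
      simp only [SetLike.mem_coe, AddMonoidHom.mem_ker, map_sub, map_add,
        FreeAbelianGroup.lift_apply_of]
    · rw [sub_eq_zero, NormalForm.ofTriple_cyc]
    · exact NormalForm.ofTriple_add_swap _ _ _
    · simp only [hlog, NormalForm.ofTriple_add_right, sub_self]
    · rw [sub_eq_zero, NormalForm.ofTriple_framing])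

theorem toNormalForm_Y (log : G → ℤ) (hlog : ∀ a b, log (a * b) = log a + log b)
    (i j k : Unit) (a b c : G) :
    toNormalForm log hlog (Y G Unit i j k a b c) =
      NormalForm.ofTriple (log a) (log b) (log c) :=
  FreeAbelianGroup.lift_apply_of _ _

/-- The homomorphism sending the standard generators of `NormalForm` to the classes
`(x^m, x^n)` and `(x^r, x^r)`. -/
noncomputable def fromNormalForm (x : G) : NormalForm →+ T1 G Unit :=
  AddMonoidHom.coprod
    (DirectSum.toAddMonoid fun b => zmultiplesHom _ (pairY G (x ^ b.val.1) (x ^ b.val.2)))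
    (DirectSum.toAddMonoid fun b => ZMod.lift 2
      ⟨zmultiplesHom _ (pairY G (x ^ b.val) (x ^ b.val)), by
        simp [two_zsmul, pairY_self_add_self]⟩)

theorem fromNormalForm_free (x : G) (b : {p : ℤ × ℤ // 1 ≤ p.1 ∧ p.1 < p.2}) :
    fromNormalForm x (DirectSum.of (fun _ => ℤ) b 1, 0) =
      pairY G (x ^ b.val.1) (x ^ b.val.2) := by
  simp [fromNormalForm]

theorem fromNormalForm_tor (x : G) (b : {r : ℤ // 0 ≤ r}) :
    fromNormalForm x (0, DirectSum.of (fun _ => ZMod 2) b 1) =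
      pairY G (x ^ b.val) (x ^ b.val) := by
  rw [fromNormalForm, AddMonoidHom.coprod_apply, map_zero, zero_add, DirectSum.toAddMonoid_of]
  have h := ZMod.lift_coe 2
    (⟨zmultiplesHom _ (pairY G (x ^ b.val) (x ^ b.val)), by
        simp [two_zsmul, pairY_self_add_self]⟩ :
      { f : ℤ →+ T1 G Unit // f ((2 : ℕ) : ℤ) = 0 }) 1
  simpa using h

theorem fromNormalForm_ofTriple (x : G) (l m n : ℤ) :
    fromNormalForm x (NormalForm.ofTriple l m n) = Y G Unit () () () (x ^ l) (x ^ m) (x ^ n) := by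
  refine NormalForm.map_ofTriple (fromNormalForm x)
    (fun l m n => Y G Unit () () () (x ^ l) (x ^ m) (x ^ n)) (fun _ _ _ => Y_cyc _ _ _ _ _ _)
    (fun _ _ _ => Y_swap _ _ _ _ _ _) (fun l m n g => ?_) (fun _ _ => Y_framing _ _ _ _)
    (fun m n h => ?_) (fun r h => ?_) l m n
  · simp only [zpow_add]
    exact (Y_mul_right _ _ _ _ _ _ _).symm
  · rw [NormalForm.ofTriple_zero_of_lt h, fromNormalForm_free, pairY, zpow_zero]
  · rw [NormalForm.ofTriple_zero_self h, fromNormalForm_tor, pairY, zpow_zero]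

end

/-- for `G = ⟨x⟩` infinite cyclic, `T₁(G)` is the internal direct sum of
the free abelian group on the basis `{(x^m, x^n) : 1 ≤ m < n}` and the elementary
abelian 2-group on the basis `{(x^r, x^r) : 0 ≤ r}`; i.e. the homomorphism from
`(⨁ ℤ) × (⨁ ZMod 2)` sending the standard generators to those elements is an
isomorphism. -/
theorem T1_int_normal_form (G : Type) [Group G] (x : G)
    (htf : ∀ n : ℤ, x ^ n = 1 → n = 0)
    (hgen : ∀ g : G, ∃ n : ℤ, g = x ^ n) :
    ∃ e : (DirectSum {p : ℤ × ℤ // 1 ≤ p.1 ∧ p.1 < p.2} (fun _ => ℤ) ×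
            DirectSum {r : ℤ // 0 ≤ r} (fun _ => ZMod 2)) ≃+ T1 G Unit,
      (∀ b : {p : ℤ × ℤ // 1 ≤ p.1 ∧ p.1 < p.2},
        e (DirectSum.of (fun _ => ℤ) b 1, 0) = pairY G (x ^ b.val.1) (x ^ b.val.2)) ∧
      (∀ b : {r : ℤ // 0 ≤ r},
        e (0, DirectSum.of (fun _ => ZMod 2) b 1) = pairY G (x ^ b.val) (x ^ b.val)) := by
  choose log hlog using hgen
  have hinj : ∀ m n : ℤ, x ^ m = x ^ n → m = n := fun m n h =>
    sub_eq_zero.mp (htf _ (by rw [zpow_sub, h, mul_inv_cancel]))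
  have hmul : ∀ a b, log (a * b) = log a + log b := fun a b =>
    hinj _ _ (by rw [← hlog, zpow_add, ← hlog, ← hlog])
  have hpow : ∀ n : ℤ, log (x ^ n) = n := fun n => hinj _ _ (hlog _).symm
  have hleft : (toNormalForm log hmul).comp (fromNormalForm x) = AddMonoidHom.id _ := by
    refine NormalForm.hom_ext (fun m n _ => ?_) (fun r _ => ?_) <;>
    simp only [AddMonoidHom.comp_apply, fromNormalForm_ofTriple, toNormalForm_Y, hpow,
      AddMonoidHom.id_apply]
  have hright : (fromNormalForm x).comp (toNormalForm log hmul) = AddMonoidHom.id _ := by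
    refine QuotientAddGroup.addMonoidHom_ext _ (FreeAbelianGroup.lift_ext _ _ ?_)
    rintro ⟨i, j, k, a, b, c⟩
    change fromNormalForm x (toNormalForm log hmul (Y G Unit i j k a b c)) = Y G Unit i j k a b c
    rw [toNormalForm_Y, fromNormalForm_ofTriple, ← hlog, ← hlog, ← hlog]
  exact ⟨AddMonoidHom.toAddEquiv _ _ hleft hright, fromNormalForm_free x, fromNormalForm_tor x⟩

end Paper
end

section
/- Let G be a group equipped with a right-invariant linear order <, and let ι be a finite linearly ordered type of labels. Then T₁(G;ι) is the internal direct sum of the free abelian subgroup with basis consisting of the classes of: Y(i,j,k;1,g,h) for i<j<k and all g,h ∈ G; Y(i,i,j;1,g,h) for i<j, 1<g, and all h ∈ G; Y(i,j,j;1,g,h) for i<j and g<h; and Y(i,i,i;1,g,h) for 1<g<h; together with the elementary abelian 2-group with basis consisting of the classes of: Y(i,i,j;1,1,g) for i<j and all g ∈ G; and Y(i,i,i;1,g,g) for 1 ≤ g. -/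
namespace Paper

variable (G : Type) [Group G] (ι : Type)

/-- Index type for the free-abelian part of the normal form of `T₁(G;ι)`. -/
abbrev FreeIdx (G : Type) [Group G] [LinearOrder G] (ι : Type) [LinearOrder ι] : Type :=
  {q : (ι × ι × ι) × G × G // q.1.1 < q.1.2.1 ∧ q.1.2.1 < q.1.2.2} ⊕
  ({q : (ι × ι) × G × G // q.1.1 < q.1.2 ∧ 1 < q.2.1} ⊕
   ({q : (ι × ι) × G × G // q.1.1 < q.1.2 ∧ q.2.1 < q.2.2} ⊕
    {q : ι × G × G // 1 < q.2.1 ∧ q.2.1 < q.2.2}))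

/-- Index type for the 2-torsion part of the normal form of `T₁(G;ι)`. -/
abbrev TorIdx (G : Type) [Group G] [LinearOrder G] (ι : Type) [LinearOrder ι] : Type :=
  {q : (ι × ι) × G // q.1.1 < q.1.2} ⊕ {q : ι × G // 1 ≤ q.2}

noncomputable instance (G : Type) [Group G] [LinearOrder G] (ι : Type) [LinearOrder ι] :
    DecidableEq (FreeIdx G ι) := Classical.decEq _

noncomputable instance (G : Type) [Group G] [LinearOrder G] (ι : Type) [LinearOrder ι] :
    DecidableEq (TorIdx G ι) := Classical.decEq _

section NormalForm

variable {G : Type} [Group G] {ι : Type}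

/-- A leg of a tree, carrying a label and a group element; legs are ordered lexicographically. -/
abbrev Leg (G ι : Type) : Type := ι ×ₗ G

/-- Right translation of the group element on a leg. -/
def Leg.shift (g : G) (x : Leg G ι) : Leg G ι := toLex ((ofLex x).1, (ofLex x).2 * g)

/-- The class of the tree with the three given legs. -/
def tree (x y z : Leg G ι) : T1 G ι :=
  Y G ι (ofLex x).1 (ofLex y).1 (ofLex z).1 (ofLex x).2 (ofLex y).2 (ofLex z).2

lemma tree_cyc (x y z : Leg G ι) : tree x y z = tree y z x := by
  refine QuotientAddGroup.eq_iff_sub_mem.2 (AddSubgroup.subset_closure ?_)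
  exact Or.inl ⟨_, _, _, _, _, _, rfl⟩

lemma tree_swap (x y z : Leg G ι) : tree x y z = -tree x z y := by
  rw [eq_neg_iff_add_eq_zero]
  refine (QuotientAddGroup.eq_zero_iff _).2 (AddSubgroup.subset_closure ?_)
  exact Or.inr (Or.inl ⟨_, _, _, _, _, _, rfl⟩)

lemma tree_shift (g : G) (x y z : Leg G ι) :
    tree (x.shift g) (y.shift g) (z.shift g) = tree x y z := by
  refine Eq.symm (QuotientAddGroup.eq_iff_sub_mem.2 (AddSubgroup.subset_closure ?_))
  exact Or.inr (Or.inr (Or.inl ⟨_, _, _, _, _, _, g, rfl⟩))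

lemma tree_framing (x y : Leg G ι) : tree x y x = tree x y y := by
  refine QuotientAddGroup.eq_iff_sub_mem.2 (AddSubgroup.subset_closure ?_)
  exact Or.inr (Or.inr (Or.inr ⟨_, _, _, _, rfl⟩))

lemma tree_self_left_comm (x y : Leg G ι) : tree x x y = tree y y x := by
  rw [tree_cyc x x y, tree_framing, tree_cyc x y y]

lemma two_smul_tree_self_left (x y : Leg G ι) : (2 : ℤ) • tree x x y = 0 := by
  have h := tree_swap y x x
  rw [← tree_cyc x y x, ← tree_cyc x x y] at h
  rw [two_smul]
  exact eq_neg_iff_add_eq_zero.1 h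

lemma T1_addHom_ext {A : Type*} [AddCommGroup A] {f f' : T1 G ι →+ A}
    (h : ∀ x y z : Leg G ι, f (tree x y z) = f' (tree x y z)) : f = f' := by
  refine QuotientAddGroup.addMonoidHom_ext _ (FreeAbelianGroup.lift_ext _ _ ?_)
  rintro ⟨i, j, k, a, b, c⟩
  exact h (toLex (i, a)) (toLex (j, b)) (toLex (k, c))

/-- A function of three legs respecting the relations extends to `T1`. -/
lemma exists_T1_lift {A : Type*} [AddCommGroup A] (F : Leg G ι → Leg G ι → Leg G ι → A)
    (hcyc : ∀ x y z, F x y z = F y z x) (hswap : ∀ x y z, F x y z = -F x z y)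
    (hshift : ∀ g x y z, F (x.shift g) (y.shift g) (z.shift g) = F x y z)
    (hframing : ∀ x y, F x y x = F x y y) :
    ∃ f : T1 G ι →+ A, ∀ x y z, f (tree x y z) = F x y z := by
  let f₀ : FreeAbelianGroup (ι × ι × ι × G × G × G) →+ A :=
    FreeAbelianGroup.lift fun p =>
      F (toLex (p.1, p.2.2.2.1)) (toLex (p.2.1, p.2.2.2.2.1)) (toLex (p.2.2.1, p.2.2.2.2.2))
  have hker : AddSubgroup.closure (T1Rels G ι) ≤ f₀.ker := by
    rw [AddSubgroup.closure_le]
    rintro _ (⟨i, j, k, a, b, c, rfl⟩ | ⟨i, j, k, a, b, c, rfl⟩ | ⟨i, j, k, a, b, c, g, rfl⟩ |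
      ⟨i, j, a, b, rfl⟩)
    · simpa [f₀, sub_eq_zero] using hcyc (toLex (i, a)) (toLex (j, b)) (toLex (k, c))
    · simpa [f₀, ← eq_neg_iff_add_eq_zero] using
        hswap (toLex (i, a)) (toLex (j, b)) (toLex (k, c))
    · simpa [f₀, sub_eq_zero, Leg.shift] using
        (hshift g (toLex (i, a)) (toLex (j, b)) (toLex (k, c))).symm
    · simpa [f₀, sub_eq_zero] using hframing (toLex (i, a)) (toLex (j, b))
  refine ⟨QuotientAddGroup.lift _ f₀ hker, fun x y z => ?_⟩
  exact FreeAbelianGroup.lift_apply_of _ _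

lemma Leg.shift_shift (g h : G) (x : Leg G ι) : (x.shift g).shift h = x.shift (g * h) := by
  simp [Leg.shift, mul_assoc]

lemma Leg.shift_inv_snd (x : Leg G ι) : (ofLex (x.shift (ofLex x).2⁻¹)).2 = 1 :=
  mul_inv_cancel _

lemma Leg.shift_one (x : Leg G ι) : x.shift 1 = x := by
  simp [Leg.shift]

/-- Translate a triple of legs so that its first group element is `1`. -/
def normTriple (x y z : Leg G ι) : Leg G ι × Leg G ι × Leg G ι :=
  (x.shift (ofLex x).2⁻¹, y.shift (ofLex x).2⁻¹, z.shift (ofLex x).2⁻¹)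

/-- Translate a pair of legs so that its first group element is `1`. -/
def normPair (x y : Leg G ι) : Leg G ι × Leg G ι :=
  (x.shift (ofLex x).2⁻¹, y.shift (ofLex x).2⁻¹)

lemma normTriple_shift (g : G) (x y z : Leg G ι) :
    normTriple (x.shift g) (y.shift g) (z.shift g) = normTriple x y z := by
  simp only [normTriple, Leg.shift_shift]
  simp [Leg.shift]

lemma normPair_shift (g : G) (x y : Leg G ι) :
    normPair (x.shift g) (y.shift g) = normPair x y := by
  simp only [normPair, Leg.shift_shift]
  simp [Leg.shift]

variable [LinearOrder G] [LinearOrder ι]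

lemma Leg.shift_strictMono (hro : ∀ f g h : G, g < h → g * f < h * f) (g : G) :
    StrictMono (Leg.shift (ι := ι) g) := by
  intro x y h
  rw [Prod.Lex.lt_iff] at h ⊢
  exact h.imp id fun h => ⟨h.1, hro _ _ _ h.2⟩

/-- The increasing triple of legs of a free basis tree. -/
def freeLegs : FreeIdx G ι → Leg G ι × Leg G ι × Leg G ι
  | .inl q => (toLex (q.1.1.1, 1), toLex (q.1.1.2.1, q.1.2.1), toLex (q.1.1.2.2, q.1.2.2))
  | .inr (.inl q) => (toLex (q.1.1.1, 1), toLex (q.1.1.1, q.1.2.1), toLex (q.1.1.2, q.1.2.2))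
  | .inr (.inr (.inl q)) =>
      (toLex (q.1.1.1, 1), toLex (q.1.1.2, q.1.2.1), toLex (q.1.1.2, q.1.2.2))
  | .inr (.inr (.inr q)) => (toLex (q.1.1, 1), toLex (q.1.1, q.1.2.1), toLex (q.1.1, q.1.2.2))

/-- The pair of legs of a torsion basis tree. -/
def torLegs : TorIdx G ι → Leg G ι × Leg G ι
  | .inl q => (toLex (q.1.1.1, 1), toLex (q.1.1.2, q.1.2))
  | .inr q => (toLex (q.1.1, 1), toLex (q.1.1, q.1.2))

lemma freeLegs_fst (q : FreeIdx G ι) : (ofLex (freeLegs q).1).2 = 1 := by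
  rcases q with q | q | q | q <;> rfl

lemma torLegs_fst (q : TorIdx G ι) : (ofLex (torLegs q).1).2 = 1 := by
  rcases q with q | q <;> rfl

lemma freeLegs_lt (q : FreeIdx G ι) :
    (freeLegs q).1 < (freeLegs q).2.1 ∧ (freeLegs q).2.1 < (freeLegs q).2.2 := by
  rcases q with ⟨q, h⟩ | ⟨q, h⟩ | ⟨q, h⟩ | ⟨q, h⟩ <;>
    simp [freeLegs, Prod.Lex.toLex_lt_toLex, h.1, h.2]

lemma torLegs_le (q : TorIdx G ι) : (torLegs q).1 ≤ (torLegs q).2 := by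
  rcases q with ⟨q, h⟩ | ⟨q, h⟩ <;> simp [torLegs, Prod.Lex.toLex_le_toLex, h]

lemma freeLegs_injective : Function.Injective (freeLegs (G := G) (ι := ι)) := by
  rintro (⟨⟨⟨i, j, k⟩, g, h⟩, hq⟩ | ⟨⟨⟨i, j⟩, g, h⟩, hq⟩ | ⟨⟨⟨i, j⟩, g, h⟩, hq⟩ | ⟨⟨i, g, h⟩, hq⟩)
    (⟨⟨⟨i', j', k'⟩, g', h'⟩, hq'⟩ | ⟨⟨⟨i', j'⟩, g', h'⟩, hq'⟩ | ⟨⟨⟨i', j'⟩, g', h'⟩, hq'⟩ |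
      ⟨⟨i', g', h'⟩, hq'⟩) heq <;>
  simp only [freeLegs, Prod.mk.injEq, EmbeddingLike.apply_eq_iff_eq] at heq hq hq' <;>
  grind

lemma torLegs_injective : Function.Injective (torLegs (G := G) (ι := ι)) := by
  rintro (⟨⟨⟨i, j⟩, g⟩, hq⟩ | ⟨⟨i, g⟩, hq⟩) (⟨⟨⟨i', j'⟩, g'⟩, hq'⟩ | ⟨⟨i', g'⟩, hq'⟩) heq <;>
  simp only [torLegs, Prod.mk.injEq, EmbeddingLike.apply_eq_iff_eq] at heq hq hq' <;>
  grind

lemma exists_freeLegs_eq {x y z : Leg G ι} (hx : (ofLex x).2 = 1) (hxy : x < y) (hyz : y < z) :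
    ∃ q, freeLegs q = (x, y, z) := by
  obtain ⟨⟨i, a⟩, rfl⟩ := toLex.surjective x
  obtain ⟨⟨j, b⟩, rfl⟩ := toLex.surjective y
  obtain ⟨⟨k, c⟩, rfl⟩ := toLex.surjective z
  obtain rfl : a = 1 := hx
  rw [Prod.Lex.toLex_lt_toLex] at hxy hyz
  rcases hxy with hij | ⟨rfl : i = j, hb⟩ <;> rcases hyz with hjk | ⟨rfl : _ = k, hc⟩
  · exact ⟨.inl ⟨((i, j, k), b, c), hij, hjk⟩, rfl⟩
  · exact ⟨.inr (.inr (.inl ⟨((i, j), b, c), hij, hc⟩)), rfl⟩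
  · exact ⟨.inr (.inl ⟨((i, k), b, c), hjk, hb⟩), rfl⟩
  · exact ⟨.inr (.inr (.inr ⟨(i, b, c), hb, hc⟩)), rfl⟩

lemma exists_torLegs_eq {x y : Leg G ι} (hx : (ofLex x).2 = 1) (hxy : x ≤ y) :
    ∃ q, torLegs q = (x, y) := by
  obtain ⟨⟨i, a⟩, rfl⟩ := toLex.surjective x
  obtain ⟨⟨j, b⟩, rfl⟩ := toLex.surjective y
  obtain rfl : a = 1 := hx
  rw [Prod.Lex.toLex_le_toLex] at hxy
  rcases hxy with hij | ⟨rfl : i = j, hb⟩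
  · exact ⟨.inl ⟨((i, j), b), hij⟩, rfl⟩
  · exact ⟨.inr ⟨(i, b), hb⟩, rfl⟩

lemma normTriple_freeLegs (q : FreeIdx G ι) :
    normTriple (freeLegs q).1 (freeLegs q).2.1 (freeLegs q).2.2 = freeLegs q := by
  simp [normTriple, freeLegs_fst, Leg.shift_one]

lemma normPair_torLegs (q : TorIdx G ι) :
    normPair (torLegs q).1 (torLegs q).2 = torLegs q := by
  simp [normPair, torLegs_fst, Leg.shift_one]

open Classical in
/-- The basis vector of the translation orbit of an increasing triple of legs, and `0` for
other triples. -/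
noncomputable def freeCoord (x y z : Leg G ι) : DirectSum (FreeIdx G ι) (fun _ => ℤ) :=
  if h : ∃ q, freeLegs q = normTriple x y z then DirectSum.of (fun _ => ℤ) h.choose 1 else 0

open Classical in
/-- The basis vector of the translation orbit of a weakly increasing pair of legs, and `0` for
other pairs. -/
noncomputable def torCoord (x y : Leg G ι) : DirectSum (TorIdx G ι) (fun _ => ZMod 2) :=
  if h : ∃ q, torLegs q = normPair x y then DirectSum.of (fun _ => ZMod 2) h.choose 1 else 0

lemma freeCoord_shift (g : G) (x y z : Leg G ι) :
    freeCoord (x.shift g) (y.shift g) (z.shift g) = freeCoord x y z := by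
  unfold freeCoord
  rw [normTriple_shift]

lemma torCoord_shift (g : G) (x y : Leg G ι) :
    torCoord (x.shift g) (y.shift g) = torCoord x y := by
  unfold torCoord
  rw [normPair_shift]

lemma freeCoord_of_eq {x y z : Leg G ι} {q : FreeIdx G ι} (h : freeLegs q = normTriple x y z) :
    freeCoord x y z = DirectSum.of (fun _ => ℤ) q 1 := by
  have h' : ∃ q, freeLegs q = normTriple x y z := ⟨q, h⟩
  rw [freeCoord, dif_pos h', freeLegs_injective (h'.choose_spec.trans h.symm)]

lemma torCoord_of_eq {x y : Leg G ι} {q : TorIdx G ι} (h : torLegs q = normPair x y) :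
    torCoord x y = DirectSum.of (fun _ => ZMod 2) q 1 := by
  have h' : ∃ q, torLegs q = normPair x y := ⟨q, h⟩
  rw [torCoord, dif_pos h', torLegs_injective (h'.choose_spec.trans h.symm)]

lemma freeCoord_eq_zero (hro : ∀ f g h : G, g < h → g * f < h * f) {x y z : Leg G ι}
    (h : ¬ (x < y ∧ y < z)) : freeCoord x y z = 0 := by
  refine dif_neg ?_
  rintro ⟨q, hq⟩
  have hlt := freeLegs_lt q
  rw [hq] at hlt
  have hmono := Leg.shift_strictMono (ι := ι) hro (ofLex x).2⁻¹
  exact h ⟨hmono.lt_iff_lt.1 hlt.1, hmono.lt_iff_lt.1 hlt.2⟩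

/-- The free component of the normal form of a tree. -/
noncomputable def freePart (x y z : Leg G ι) : DirectSum (FreeIdx G ι) (fun _ => ℤ) :=
  freeCoord x y z + freeCoord y z x + freeCoord z x y
    - freeCoord x z y - freeCoord z y x - freeCoord y x z

/-- The torsion component of the normal form of a tree. -/
noncomputable def torPart (x y z : Leg G ι) : DirectSum (TorIdx G ι) (fun _ => ZMod 2) :=
  if x = y then torCoord (min x z) (max x z)
  else if y = z ∨ z = x then torCoord (min x y) (max x y) else 0

lemma torPart_self_left (x y : Leg G ι) : torPart x x y = torCoord (min x y) (max x y) :=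
  if_pos rfl

lemma add_self_eq_zero_of_zmod_two {σ : Type*} [DecidableEq σ]
    (d : DirectSum σ (fun _ => ZMod 2)) : d + d = 0 :=
  DFinsupp.ext fun i => CharTwo.add_self_eq_zero (d i)

lemma exists_toNormalForm (hro : ∀ f g h : G, g < h → g * f < h * f) :
    ∃ ψ : T1 G ι →+ (DirectSum (FreeIdx G ι) (fun _ => ℤ) ×
        DirectSum (TorIdx G ι) (fun _ => ZMod 2)),
      ∀ x y z, ψ (tree x y z) = (freePart x y z, torPart x y z) := by
  have hneg (d : DirectSum (TorIdx G ι) (fun _ => ZMod 2)) : -d = d :=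
    neg_eq_of_add_eq_zero_left (add_self_eq_zero_of_zmod_two d)
  refine exists_T1_lift (fun x y z => (freePart x y z, torPart x y z)) ?_ ?_ ?_ ?_
  · intro x y z
    refine Prod.ext (by simp only [freePart]; abel) ?_
    simp only [torPart]
    grind
  · intro x y z
    refine Prod.ext (by simp only [freePart, Prod.fst_neg]; abel) ?_
    simp only [torPart, Prod.snd_neg, hneg]
    grind
  · intro g x y z
    have hmono := Leg.shift_strictMono (ι := ι) hro g
    refine Prod.ext (by simp only [freePart, freeCoord_shift]) ?_
    simp only [torPart, hmono.injective.eq_iff, ← hmono.monotone.map_min, ← hmono.monotone.map_max,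
      torCoord_shift]
  · intro x y
    refine Prod.ext (by simp only [freePart]; abel) ?_
    simp only [torPart]
    grind

/-- The homomorphism sending each basis vector to its tree. -/
noncomputable def ofNormalForm : (DirectSum (FreeIdx G ι) (fun _ => ℤ) ×
    DirectSum (TorIdx G ι) (fun _ => ZMod 2)) →+ T1 G ι :=
  AddMonoidHom.coprod
    (DirectSum.toAddMonoid fun q =>
      zmultiplesHom _ (tree (freeLegs q).1 (freeLegs q).2.1 (freeLegs q).2.2))
    (DirectSum.toAddMonoid fun q =>
      ZMod.lift 2 ⟨zmultiplesHom _ (tree (torLegs q).1 (torLegs q).1 (torLegs q).2),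
        two_smul_tree_self_left _ _⟩)

lemma ofNormalForm_free (q : FreeIdx G ι) :
    ofNormalForm (DirectSum.of (fun _ => ℤ) q 1, 0) =
      tree (freeLegs q).1 (freeLegs q).2.1 (freeLegs q).2.2 := by
  simp [ofNormalForm]

lemma ofNormalForm_tor (q : TorIdx G ι) :
    ofNormalForm (0, DirectSum.of (fun _ => ZMod 2) q 1) =
      tree (torLegs q).1 (torLegs q).1 (torLegs q).2 := by
  have h := ZMod.lift_coe 2 ⟨zmultiplesHom _ (tree (torLegs q).1 (torLegs q).1 (torLegs q).2),
    two_smul_tree_self_left (torLegs q).1 (torLegs q).2⟩ 1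
  simpa [ofNormalForm] using h

lemma freePart_of_lt (hro : ∀ f g h : G, g < h → g * f < h * f) {x y z : Leg G ι}
    (hxy : x < y) (hyz : y < z) : freePart x y z = freeCoord x y z := by
  have hxz := hxy.trans hyz
  rw [freePart, freeCoord_eq_zero hro (x := y) (y := z), freeCoord_eq_zero hro (x := z) (y := x),
    freeCoord_eq_zero hro (x := x) (y := z), freeCoord_eq_zero hro (x := z) (y := y),
    freeCoord_eq_zero hro (x := y) (y := x)]
  · abel
  all_goals simp [hxy.not_gt, hyz.not_gt, hxz.not_gt]

lemma torPart_of_lt {x y z : Leg G ι} (hxy : x < y) (hyz : y < z) : torPart x y z = 0 := by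
  rw [torPart, if_neg hxy.ne, if_neg]
  rintro (h | h)
  exacts [hyz.ne h, (hxy.trans hyz).ne' h]

lemma freePart_self_left (x y : Leg G ι) : freePart x x y = 0 := by
  rw [freePart]; abel

lemma ofNormalForm_freeCoord (hro : ∀ f g h : G, g < h → g * f < h * f) {x y z : Leg G ι}
    (hxy : x < y) (hyz : y < z) : ofNormalForm (freeCoord x y z, 0) = tree x y z := by
  have hmono := Leg.shift_strictMono (ι := ι) hro (ofLex x).2⁻¹
  obtain ⟨q, hq⟩ := exists_freeLegs_eq x.shift_inv_snd (hmono hxy) (hmono hyz)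
  rw [freeCoord_of_eq hq, ofNormalForm_free, hq, tree_shift]

lemma ofNormalForm_torCoord (hro : ∀ f g h : G, g < h → g * f < h * f) {x y : Leg G ι}
    (hxy : x ≤ y) : ofNormalForm (0, torCoord x y) = tree x x y := by
  have hmono := Leg.shift_strictMono (ι := ι) hro (ofLex x).2⁻¹
  obtain ⟨q, hq⟩ := exists_torLegs_eq x.shift_inv_snd (hmono.monotone hxy)
  rw [torCoord_of_eq hq, ofNormalForm_tor, hq, tree_shift]

/-- An endomorphism of `T1` fixing the sorted trees and the trees with two equal legs is the
identity. -/
lemma eq_id_of_sorted {f : T1 G ι →+ T1 G ι}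
    (hlt : ∀ x y z : Leg G ι, x < y → y < z → f (tree x y z) = tree x y z)
    (heq : ∀ x y : Leg G ι, x ≤ y → f (tree x x y) = tree x x y) : f = AddMonoidHom.id _ := by
  have hcyc {x y z : Leg G ι} (h : f (tree x y z) = tree x y z) :
      f (tree y z x) = tree y z x := by rwa [← tree_cyc]
  have hswap {x y z : Leg G ι} (h : f (tree x y z) = tree x y z) :
      f (tree x z y) = tree x z y := by rw [tree_swap, map_neg, h]
  have heq' (x y : Leg G ι) : f (tree x x y) = tree x x y := by
    rcases le_total x y with h | h
    · exact heq x y h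
    · rw [tree_self_left_comm]
      exact heq y x h
  refine T1_addHom_ext fun x y z => ?_
  change f (tree x y z) = tree x y z
  rcases lt_trichotomy x y with hxy | rfl | hxy
  · rcases lt_trichotomy y z with hyz | rfl | hyz
    · exact hlt x y z hxy hyz
    · exact hcyc (hcyc (heq' y x))
    · rcases lt_trichotomy x z with hxz | rfl | hxz
      · exact hswap (hlt x z y hxz hyz)
      · exact hcyc (heq' x y)
      · exact hcyc (hlt z x y hxz hxy)
  · exact heq' x z
  · rcases lt_trichotomy y z with hyz | rfl | hyz
    · rcases lt_trichotomy x z with hxz | rfl | hxz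
      · exact hcyc (hcyc (hswap (hlt y x z hxy hxz)))
      · exact hcyc (heq' x y)
      · exact hcyc (hcyc (hlt y z x hyz hxz))
    · exact hcyc (hcyc (heq' y x))
    · exact hswap (hcyc (hcyc (hlt z y x hyz hxy)))

lemma ofNormalForm_comp (hro : ∀ f g h : G, g < h → g * f < h * f)
    {ψ : T1 G ι →+ (DirectSum (FreeIdx G ι) (fun _ => ℤ) ×
      DirectSum (TorIdx G ι) (fun _ => ZMod 2))}
    (hψ : ∀ x y z, ψ (tree x y z) = (freePart x y z, torPart x y z)) :
    ofNormalForm.comp ψ = AddMonoidHom.id _ := by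
  refine eq_id_of_sorted (fun x y z hxy hyz => ?_) fun x y hxy => ?_
  · rw [AddMonoidHom.comp_apply, hψ, freePart_of_lt hro hxy hyz, torPart_of_lt hxy hyz,
      ofNormalForm_freeCoord hro hxy hyz]
  · rw [AddMonoidHom.comp_apply, hψ, freePart_self_left, torPart_self_left, min_eq_left hxy,
      max_eq_right hxy, ofNormalForm_torCoord hro hxy]

lemma comp_ofNormalForm (hro : ∀ f g h : G, g < h → g * f < h * f)
    {ψ : T1 G ι →+ (DirectSum (FreeIdx G ι) (fun _ => ℤ) ×
      DirectSum (TorIdx G ι) (fun _ => ZMod 2))}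
    (hψ : ∀ x y z, ψ (tree x y z) = (freePart x y z, torPart x y z)) :
    ψ.comp ofNormalForm = AddMonoidHom.id _ := by
  rw [← AddMonoidHom.coprod_unique (ψ.comp ofNormalForm), ← AddMonoidHom.coprod_inl_inr]
  congr 1
  · refine DirectSum.addHom_ext' fun q => AddMonoidHom.ext_int ?_
    change ψ (ofNormalForm (DirectSum.of (fun _ => ℤ) q 1, 0)) = (DirectSum.of (fun _ => ℤ) q 1, 0)
    obtain ⟨hxy, hyz⟩ := freeLegs_lt q
    rw [ofNormalForm_free, hψ, freePart_of_lt hro hxy hyz, torPart_of_lt hxy hyz,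
      freeCoord_of_eq (normTriple_freeLegs q).symm]
  · refine DirectSum.addHom_ext' fun q => ?_
    refine (AddMonoidHom.cancel_right (ZMod.ringHom_surjective (Int.castRingHom (ZMod 2)))).1
      (AddMonoidHom.ext_int (f := AddMonoidHom.comp _ (Int.castAddHom (ZMod 2)))
        (g := AddMonoidHom.comp _ (Int.castAddHom (ZMod 2))) ?_)
    simp only [AddMonoidHom.comp_apply, Int.coe_castAddHom, Int.cast_one]
    change ψ (ofNormalForm (0, DirectSum.of (fun _ => ZMod 2) q 1)) =
      (0, DirectSum.of (fun _ => ZMod 2) q 1)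
    rw [ofNormalForm_tor, hψ, freePart_self_left, torPart_self_left, min_eq_left (torLegs_le q),
      max_eq_right (torLegs_le q), torCoord_of_eq (normPair_torLegs q).symm]

end NormalForm

/-- normal form for `T₁(G;ι)` with `G` right-ordered and `ι` a finite
linearly ordered label type: `T₁(G;ι)` is the internal direct sum of the free abelian
group on the classes `Y(i,j,k;1,g,h)` (`i<j<k`), `Y(i,i,j;1,g,h)` (`i<j`, `1<g`),
`Y(i,j,j;1,g,h)` (`i<j`, `g<h`), `Y(i,i,i;1,g,h)` (`1<g<h`), and the elementary
abelian 2-group on the classes `Y(i,i,j;1,1,g)` (`i<j`) and `Y(i,i,i;1,g,g)`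
(`1 ≤ g`). -/
theorem T1_multilabel_normal_form (G : Type) [Group G] [LinearOrder G]
    (hro : ∀ f g h : G, g < h → g * f < h * f)
    (ι : Type) [Fintype ι] [LinearOrder ι] :
    ∃ e : (DirectSum (FreeIdx G ι) (fun _ => ℤ) ×
           DirectSum (TorIdx G ι) (fun _ => ZMod 2)) ≃+ T1 G ι,
      (∀ q : {q : (ι × ι × ι) × G × G // q.1.1 < q.1.2.1 ∧ q.1.2.1 < q.1.2.2},
        e (DirectSum.of (fun _ : FreeIdx G ι => ℤ) (Sum.inl q) 1, 0) =
          Y G ι q.val.1.1 q.val.1.2.1 q.val.1.2.2 1 q.val.2.1 q.val.2.2) ∧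
      (∀ q : {q : (ι × ι) × G × G // q.1.1 < q.1.2 ∧ 1 < q.2.1},
        e (DirectSum.of (fun _ : FreeIdx G ι => ℤ) (Sum.inr (Sum.inl q)) 1, 0) =
          Y G ι q.val.1.1 q.val.1.1 q.val.1.2 1 q.val.2.1 q.val.2.2) ∧
      (∀ q : {q : (ι × ι) × G × G // q.1.1 < q.1.2 ∧ q.2.1 < q.2.2},
        e (DirectSum.of (fun _ : FreeIdx G ι => ℤ) (Sum.inr (Sum.inr (Sum.inl q))) 1, 0) =
          Y G ι q.val.1.1 q.val.1.2 q.val.1.2 1 q.val.2.1 q.val.2.2) ∧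
      (∀ q : {q : ι × G × G // 1 < q.2.1 ∧ q.2.1 < q.2.2},
        e (DirectSum.of (fun _ : FreeIdx G ι => ℤ) (Sum.inr (Sum.inr (Sum.inr q))) 1, 0) =
          Y G ι q.val.1 q.val.1 q.val.1 1 q.val.2.1 q.val.2.2) ∧
      (∀ q : {q : (ι × ι) × G // q.1.1 < q.1.2},
        e (0, DirectSum.of (fun _ : TorIdx G ι => ZMod 2) (Sum.inl q) 1) =
          Y G ι q.val.1.1 q.val.1.1 q.val.1.2 1 1 q.val.2) ∧
      (∀ q : {q : ι × G // 1 ≤ q.2},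
        e (0, DirectSum.of (fun _ : TorIdx G ι => ZMod 2) (Sum.inr q) 1) =
          Y G ι q.val.1 q.val.1 q.val.1 1 q.val.2 q.val.2) := by
  obtain ⟨ψ, hψ⟩ := exists_toNormalForm (ι := ι) hro
  refine ⟨AddMonoidHom.toAddEquiv ofNormalForm ψ (comp_ofNormalForm hro hψ)
    (ofNormalForm_comp hro hψ), fun q => ofNormalForm_free _, fun q => ofNormalForm_free _,
    fun q => ofNormalForm_free _, fun q => ofNormalForm_free _, fun q => ofNormalForm_tor _,
    fun q => ?_⟩
  refine (ofNormalForm_tor _).trans ?_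
  rw [tree_cyc, tree_framing]
  rfl

end Paper
end

section
/- Let K be the Klein-bottle group, with elements aⁿf^l = (n,l) for n,l ∈ ℤ, and let T₀(K) be the single-label order-0 intersection-tree group, with [g] denoting the class of g ∈ K. For r,s ∈ ℤ let ψ = a^{2r+1}f^s, and let σ : T₀(K) → T₀(K) be the automorphism induced by [g] ↦ [ψ·g·ψ⁻¹]. Then an element z ∈ T₀(K) satisfies σ(z) = z if and only if z lies in the subgroup of T₀(K) generated by the elements: [a^{2k}] for k ∈ ℤ; [f^l] for l ∈ ℤ; [a^{2k}f^l] + [a^{2k}f^{−l}] for k,l ∈ ℤ; [a^{2k+1}f^s] for k ∈ ℤ; and [a^{2k+1}f^l] + [a^{2k+1}f^{2s−l}] for k,l ∈ ℤ. -/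
namespace Paper

/-- The Klein-bottle group: underlying set `ℤ × ℤ` with multiplication
`(n,l)·(m,k) = (n+m, (−1)^m·l + k)`. -/
@[ext] structure KB where
  /-- exponent of `a` -/
  n : ℤ
  /-- exponent of `f` -/
  l : ℤ

namespace KB

instance : One KB := ⟨⟨0, 0⟩⟩
instance : Mul KB := ⟨fun x y => ⟨x.n + y.n, (y.n.negOnePow : ℤ) * x.l + y.l⟩⟩
instance : Inv KB := ⟨fun x => ⟨-x.n, -((x.n.negOnePow : ℤ) * x.l)⟩⟩

@[simp] lemma one_n : (1 : KB).n = 0 := rfl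
@[simp] lemma one_l : (1 : KB).l = 0 := rfl
@[simp] lemma mul_n (x y : KB) : (x * y).n = x.n + y.n := rfl
@[simp] lemma mul_l (x y : KB) : (x * y).l = (y.n.negOnePow : ℤ) * x.l + y.l := rfl
@[simp] lemma inv_n (x : KB) : x⁻¹.n = -x.n := rfl
@[simp] lemma inv_l (x : KB) : x⁻¹.l = -((x.n.negOnePow : ℤ) * x.l) := rfl

instance : Group KB where
  mul_assoc x y z := by
    ext
    · simp [add_assoc]
    · simp [Int.negOnePow_add, Units.val_mul]
      ring
  one_mul x := by ext <;> simp
  mul_one x := by ext <;> simp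
  inv_mul_cancel x := by
    ext
    · simp
    · simp
      rw [← mul_assoc, ← Units.val_mul, Int.units_mul_self]
      simp

/-- The generator `a = (1,0)`, a core of the Möbius band. -/
def a : KB := ⟨1, 0⟩

/-- The generator `f = (0,1)`, a circle fiber. -/
def f : KB := ⟨0, 1⟩

end KB

/-- Relator set for the single-label order-0 intersection-tree group `T₀(G)`:
`[g] = [g⁻¹]` and `[1] = 0`. -/
def T0sRels (G : Type) [Group G] : Set (FreeAbelianGroup G) :=
  { x | (∃ g : G, x = FreeAbelianGroup.of g - FreeAbelianGroup.of g⁻¹)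
      ∨ x = FreeAbelianGroup.of (1 : G) }

/-- The single-label order-0 intersection-tree group `T₀(G)`. -/
abbrev T0s (G : Type) [Group G] := FreeAbelianGroup G ⧸ AddSubgroup.closure (T0sRels G)

/-- The class `[g]` of `g ∈ G` in `T₀(G)`. -/
def cls {G : Type} [Group G] (g : G) : T0s G :=
  QuotientAddGroup.mk (FreeAbelianGroup.of g)

section T0s

variable {G : Type} [Group G]

lemma cls_one : cls (1 : G) = 0 :=
  (QuotientAddGroup.eq_zero_iff _).2 (AddSubgroup.subset_closure (Or.inr rfl))

lemma cls_inv (g : G) : cls g⁻¹ = cls g := by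
  refine (QuotientAddGroup.eq_iff_sub_mem.2 ?_).symm
  exact AddSubgroup.subset_closure (Or.inl ⟨g, rfl⟩)

lemma T0s_induction {p : T0s G → Prop} (zero : p 0) (cls : ∀ g, p (cls g))
    (neg : ∀ x, p x → p (-x)) (add : ∀ x y, p x → p y → p (x + y)) (z : T0s G) : p z := by
  induction z using QuotientAddGroup.induction_on with
  | H x =>
    induction x using FreeAbelianGroup.induction_on with
    | zero => exact zero
    | of g => exact cls g
    | neg g h => exact neg _ h
    | add x y hx hy => exact add _ _ hx hy

lemma T0s_hom_ext {A : Type*} [AddCommGroup A] {φ χ : T0s G →+ A}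
    (h : ∀ g, φ (cls g) = χ (cls g)) (z : T0s G) : φ z = χ z := by
  induction z using T0s_induction with
  | zero => simp
  | cls g => exact h g
  | neg x hx => simp [hx]
  | add x y hx hy => simp [hx, hy]

/-- The endomorphism `[g] ↦ c(g)·[g]` of `T₀(G)` for an inversion-invariant weight `c`. -/
def weightHom (c : G → ℤ) (hc : ∀ g, c g⁻¹ = c g) : T0s G →+ T0s G :=
  QuotientAddGroup.lift _ (FreeAbelianGroup.lift fun g => c g • cls g) <| by
    rw [AddSubgroup.closure_le]
    rintro x (⟨g, rfl⟩ | rfl)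
    · simp [hc, cls_inv]
    · simp [cls_one]

@[simp] lemma weightHom_cls (c : G → ℤ) (hc : ∀ g, c g⁻¹ = c g) (g : G) :
    weightHom c hc (cls g) = c g • cls g := by
  simp [weightHom, cls]

/-- If an involution `τ` of `G` reverses the sign of an inversion-invariant function, then the
points of `T₀(G)` fixed by the induced map lie in every subgroup containing the classes of
sign zero and the orbit sums. -/
lemma mem_of_fixed_of_sign_reversing (σ : T0s G →+ T0s G) (τ : G → G)
    (hσ : ∀ g, σ (cls g) = cls (τ g)) (hττ : ∀ g, τ (τ g) = g)
    (c : G → ℤ) (hinv : ∀ g, c g⁻¹ = c g) (hτ : ∀ g, c (τ g) = -c g)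
    (C : AddSubgroup (T0s G)) (hfix : ∀ g, c g = 0 → cls g ∈ C)
    (hsum : ∀ g, cls g + cls (τ g) ∈ C) {z : T0s G} (hz : σ z = z) : z ∈ C := by
  let h := weightHom (fun g => if 0 < c g then 1 else 0) (by simp [hinv])
  let e := weightHom (fun g => if c g = 0 then 1 else 0) (by simp [hinv])
  have decomp : z = (h z + σ (h (σ z))) + e z := by
    refine T0s_hom_ext (φ := AddMonoidHom.id _) (χ := h + σ.comp (h.comp σ) + e) (fun g => ?_) z
    rcases lt_trichotomy (c g) 0 with hg | hg | hg
    · simp [h, e, hσ, hττ, hτ, hg, hg.ne, hg.not_gt]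
    · simp [h, e, hσ, hτ, hg]
    · simp [h, e, hσ, hτ, hg, hg.ne', hg.not_gt]
  have hmem (w : T0s G) : h w + σ (h w) ∈ C := by
    induction w using T0s_induction with
    | zero => simp
    | cls g =>
      by_cases hg : 0 < c g
      · simpa [h, hg, hσ] using hsum g
      · simp [h, hg]
    | neg x hx => simpa [add_comm] using C.neg_mem hx
    | add x y hx hy => simpa [add_add_add_comm] using C.add_mem hx hy
  have emem (w : T0s G) : e w ∈ C := by
    induction w using T0s_induction with
    | zero => simp
    | cls g =>
      by_cases hg : c g = 0
      · simpa [e, hg] using hfix g hg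
      · simp [e, hg]
    | neg x hx => simpa using hx
    | add x y hx hy => simpa using C.add_mem hx hy
  rw [decomp, hz]
  exact C.add_mem (hmem z) (emem z)

end T0s

namespace KB

lemma a_zpow (n : ℤ) : a ^ n = ⟨n, 0⟩ := by
  induction n with
  | zero => rfl
  | succ i ih => rw [zpow_add_one, ih]; ext <;> simp [a]
  | pred i ih => rw [zpow_sub_one, ih]; ext <;> simp [a, sub_eq_add_neg]

lemma f_zpow (l : ℤ) : f ^ l = ⟨0, l⟩ := by
  induction l with
  | zero => rfl
  | succ i ih => rw [zpow_add_one, ih]; ext <;> simp [f]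
  | pred i ih => rw [zpow_sub_one, ih]; ext <;> simp [f, sub_eq_add_neg]

lemma a_zpow_mul_f_zpow (n l : ℤ) : a ^ n * f ^ l = ⟨n, l⟩ := by
  rw [a_zpow, f_zpow]; ext <;> simp

lemma conj_even (r s k l : ℤ) :
    (⟨2 * r + 1, s⟩ * ⟨2 * k, l⟩ * ⟨2 * r + 1, s⟩⁻¹ : KB) = ⟨2 * k, -l⟩ := by
  ext
  · simp only [mul_n, inv_n]; ring
  · simp [Int.negOnePow_add, Int.negOnePow_two_mul]

lemma conj_odd (r s k l : ℤ) :
    (⟨2 * r + 1, s⟩ * ⟨2 * k + 1, l⟩ * ⟨2 * r + 1, s⟩⁻¹ : KB) = ⟨2 * k + 1, 2 * s - l⟩ := by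
  ext
  · simp only [mul_n, inv_n]; ring
  · simp [Int.negOnePow_add, Int.negOnePow_two_mul]
    ring

lemma parity_cases {p : KB → Prop} (even : ∀ k l, p ⟨2 * k, l⟩) (odd : ∀ k l, p ⟨2 * k + 1, l⟩)
    (g : KB) : p g := by
  obtain ⟨n, l⟩ := g
  obtain ⟨k, rfl | rfl⟩ := Int.even_or_odd' n
  exacts [even k l, odd k l]

lemma inv_even (k l : ℤ) : (⟨2 * k, l⟩⁻¹ : KB) = ⟨2 * -k, -l⟩ := by
  ext <;> simp [Int.negOnePow_two_mul]

lemma inv_odd (k l : ℤ) : (⟨2 * k + 1, l⟩⁻¹ : KB) = ⟨2 * (-k - 1) + 1, l⟩ := by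
  ext
  · simp; ring
  · simp [Int.negOnePow_add, Int.negOnePow_two_mul]

/-- An inversion-invariant function on `K` whose sign is reversed by conjugation by
`a^{2r+1} f^s`. -/
def orbitSign (s : ℤ) (g : KB) : ℤ := if Even g.n then g.n * g.l else g.l - s

lemma orbitSign_even (s k l : ℤ) : orbitSign s ⟨2 * k, l⟩ = 2 * k * l := by
  simp [orbitSign]

lemma orbitSign_odd (s k l : ℤ) : orbitSign s ⟨2 * k + 1, l⟩ = l - s := by
  simp [orbitSign]

end KB

open KB in
/-- for `ψ = a^{2r+1} f^s` and `σ` the automorphism of `T₀(K)` induced by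
`[g] ↦ [ψ g ψ⁻¹]`, an element `z ∈ T₀(K)` is fixed by `σ` if and only if `z` lies in
the subgroup generated by the classes `[a^{2k}]`, `[f^l]`, `[a^{2k}f^l] + [a^{2k}f^{−l}]`,
`[a^{2k+1}f^s]`, and `[a^{2k+1}f^l] + [a^{2k+1}f^{2s−l}]`. -/
theorem fixed_points_T0_KB (r s : ℤ) (σ : T0s KB ≃+ T0s KB)
    (hσ : ∀ g : KB, σ (cls g) =
      cls ((a ^ (2 * r + 1) * f ^ s) * g * (a ^ (2 * r + 1) * f ^ s)⁻¹)) :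
    ∀ z : T0s KB, σ z = z ↔ z ∈ AddSubgroup.closure
      ({w : T0s KB | ∃ k : ℤ, w = cls (a ^ (2 * k))} ∪
       {w : T0s KB | ∃ l : ℤ, w = cls (f ^ l)} ∪
       {w : T0s KB | ∃ k l : ℤ,
          w = cls (a ^ (2 * k) * f ^ l) + cls (a ^ (2 * k) * f ^ (-l))} ∪
       {w : T0s KB | ∃ k : ℤ, w = cls (a ^ (2 * k + 1) * f ^ s)} ∪
       {w : T0s KB | ∃ k l : ℤ,
          w = cls (a ^ (2 * k + 1) * f ^ l) + cls (a ^ (2 * k + 1) * f ^ (2 * s - l))}) := by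
  simp only [a_zpow_mul_f_zpow] at hσ ⊢
  simp only [a_zpow, f_zpow]
  intro z
  constructor
  · intro hz
    refine mem_of_fixed_of_sign_reversing σ.toAddMonoidHom _ hσ (fun g => ?_) (orbitSign s)
      (fun g => ?_) (fun g => ?_) _ (fun g => ?_) (fun g => ?_) hz
    · induction g using parity_cases with
      | even k l => simp only [conj_even, neg_neg]
      | odd k l => simp only [conj_odd, sub_sub_cancel]
    · induction g using parity_cases with
      | even k l => rw [inv_even, orbitSign_even, orbitSign_even]; ring
      | odd k l => rw [inv_odd, orbitSign_odd, orbitSign_odd]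
    · induction g using parity_cases with
      | even k l => rw [conj_even, orbitSign_even, orbitSign_even]; ring
      | odd k l => rw [conj_odd, orbitSign_odd, orbitSign_odd]; ring
    · induction g using parity_cases with
      | even k l =>
        rw [orbitSign_even]
        intro h
        apply AddSubgroup.subset_closure
        obtain rfl | rfl : k = 0 ∨ l = 0 := by simpa using h
        · exact .inl (.inl (.inl (.inr ⟨l, rfl⟩)))
        · exact .inl (.inl (.inl (.inl ⟨k, rfl⟩)))
      | odd k l =>
        rw [orbitSign_odd, sub_eq_zero]
        rintro rfl
        exact AddSubgroup.subset_closure (.inl (.inr ⟨k, rfl⟩))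
    · apply AddSubgroup.subset_closure
      induction g using parity_cases with
      | even k l => rw [conj_even]; exact .inl (.inl (.inr ⟨k, l, rfl⟩))
      | odd k l => rw [conj_odd]; exact .inr ⟨k, l, rfl⟩
  · intro hz
    have σ_even (k l : ℤ) : σ (cls ⟨2 * k, l⟩) = cls ⟨2 * k, -l⟩ := by rw [hσ, conj_even]
    have σ_odd (k l : ℤ) : σ (cls ⟨2 * k + 1, l⟩) = cls ⟨2 * k + 1, 2 * s - l⟩ := by
      rw [hσ, conj_odd]
    induction hz using AddSubgroup.closure_induction with
    | mem w hw =>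
      obtain (((⟨k, rfl⟩ | ⟨l, rfl⟩) | ⟨k, l, rfl⟩) | ⟨k, rfl⟩) | ⟨k, l, rfl⟩ := hw
      · rw [σ_even, neg_zero]
      · have h := σ_even 0 l
        have h' := inv_even 0 l
        simp only [neg_zero, mul_zero] at h h'
        rw [h, ← h', cls_inv]
      · rw [map_add, σ_even, σ_even, neg_neg, add_comm]
      · rw [σ_odd, two_mul s, add_sub_cancel_right]
      · rw [map_add, σ_odd, σ_odd, sub_sub_cancel, add_comm]
    | zero => exact map_zero σ
    | add x y _ _ hx hy => rw [map_add, hx, hy]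
    | neg x _ hx => rw [map_neg, hx]

end Paper
end
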